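/- arXiv:1507.00664 — 2 statements merged into one kernel-verified Lean document; each statement's English description precedes it below -/
import Mathlib

section
/- Let X be a countable set, A a set of actions, A(x) ⊆ A nonempty for each x ∈ X, and q(y|x,a) ≥ 0 transition rates with sup_{x,a} Σ_y q(y|x,a) < ∞. Suppose there is a constant K ≥ 1 such that for every stationary policy φ : X → A (with φ(x) ∈ A(x)), the matrix Q_φ with entries q(y|x,φ(x)) satisfies ‖Σ_{n=0}^∞ Q_φⁿ‖ ≤ K. Then there exists a function μ : X → [0, K] satisfying μ(x) ≥ 1 + Σ_{y∈X} q(y|x,a)·μ(y) for all x ∈ X and a ∈ A(x). -/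
open scoped ENNReal

/-- Matrix powers of a nonnegative matrix over a countable index set. -/
noncomputable def matPow {X : Type*} [DecidableEq X] (Q : X → X → ℝ≥0∞) : ℕ → X → X → ℝ≥0∞
  | 0 => fun x y => if x = y then 1 else 0
  | n + 1 => fun x y => ∑' z, Q x z * matPow Q n z y

/-- The total mass of row `x` of the `n`-th power of `Q`. -/
noncomputable def rowMass {X : Type*} [DecidableEq X] (Q : X → X → ℝ≥0∞) (n : ℕ) (x : X) : ℝ≥0∞ :=
  ∑' y, matPow Q n x y

theorem rowMass_zero {X : Type*} [DecidableEq X] (Q : X → X → ℝ≥0∞) (x : X) :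
    rowMass Q 0 x = 1 := by
  simp [rowMass, matPow]

theorem rowMass_succ {X : Type*} [DecidableEq X] (Q : X → X → ℝ≥0∞) (n : ℕ) (x : X) :
    rowMass Q (n + 1) x = ∑' z, Q x z * rowMass Q n z := by
  simp only [rowMass, matPow]
  rw [ENNReal.tsum_comm]
  simp only [ENNReal.tsum_mul_left]

theorem tsum_rowMass_eq {X : Type*} [DecidableEq X] (Q : X → X → ℝ≥0∞) (x : X) :
    ∑' n, rowMass Q n x = 1 + ∑' z, Q x z * ∑' n, rowMass Q n z := by
  rw [tsum_eq_zero_add' ENNReal.summable, rowMass_zero]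
  simp only [rowMass_succ]
  rw [ENNReal.tsum_comm]
  simp only [ENNReal.tsum_mul_left]

theorem le_sum_rowMass_add {X : Type*} [DecidableEq X] {Q : X → X → ℝ≥0∞} {u : X → ℝ≥0∞}
    {c K : ℝ≥0∞} (hK : ∀ x, u x ≤ K) (hu : ∀ x, u x ≤ c + ∑' z, Q x z * u z) (n : ℕ) (x : X) :
    u x ≤ c * ∑ k ∈ Finset.range n, rowMass Q k x + K * rowMass Q n x := by
  induction n generalizing x with
  | zero => simpa [rowMass_zero] using hK x
  | succ n ih =>
    calc u x ≤ c + ∑' z, Q x z * u z := hu x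
      _ ≤ c + ∑' z, Q x z * (c * ∑ k ∈ Finset.range n, rowMass Q k z + K * rowMass Q n z) := by
        gcongr with z
        exact ih z
      _ = c + ∑' z, (c * ∑ k ∈ Finset.range n, Q x z * rowMass Q k z
            + K * (Q x z * rowMass Q n z)) := by
        congr 2 with z
        rw [← Finset.mul_sum]
        ring
      _ = _ := by
        rw [ENNReal.tsum_add, ENNReal.tsum_mul_left, ENNReal.tsum_mul_left,
          Summable.tsum_finsetSum fun _ _ => ENNReal.summable, Finset.sum_range_succ']
        simp only [rowMass_succ, rowMass_zero]
        ring

/-- A bounded solution of `u ≤ c + Q u` is dominated by `c` times the total mass of the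
Neumann series of `Q`, when the latter is finite. -/
theorem le_mul_tsum_rowMass {X : Type*} [DecidableEq X] {Q : X → X → ℝ≥0∞} {u : X → ℝ≥0∞}
    {c K : ℝ≥0∞} (hKtop : K ≠ ⊤) (hK : ∀ x, u x ≤ K)
    (hu : ∀ x, u x ≤ c + ∑' z, Q x z * u z) (x : X) (hx : ∑' n, rowMass Q n x ≠ ⊤) :
    u x ≤ c * ∑' n, rowMass Q n x := by
  have hlim : Filter.Tendsto (fun n => c * ∑' n, rowMass Q n x + K * rowMass Q n x)
      Filter.atTop (nhds (c * ∑' n, rowMass Q n x + K * 0)) :=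
    tendsto_const_nhds.add (ENNReal.Tendsto.const_mul
      (ENNReal.tendsto_atTop_zero_of_tsum_ne_top hx) (Or.inr hKtop))
  rw [mul_zero, add_zero] at hlim
  refine ge_of_tendsto' hlim fun n => (le_sum_rowMass_add hK hu n x).trans ?_
  gcongr
  exact ENNReal.sum_le_tsum _

/-- under Assumption T (all stationary policies are transient with uniform
bound `K ≥ 1`), there is a function `μ : X → [0, K]` with
`μ(x) ≥ 1 + ∑_y q(y|x,a) μ(y)` for all `x` and all `a ∈ A(x)`. -/
theorem stmt1 {X A : Type*} [Countable X] [DecidableEq X]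
    (Act : X → Set A) (hAct : ∀ x, (Act x).Nonempty)
    (q : X → A → X → ℝ≥0∞)
    (hq : ∃ C : ℝ≥0∞, C ≠ ⊤ ∧ ∀ x, ∀ a ∈ Act x, ∑' y, q x a y ≤ C)
    (K : ℝ≥0∞) (hK1 : 1 ≤ K) (hKtop : K ≠ ⊤)
    (hT : ∀ φ : X → A, (∀ x, φ x ∈ Act x) →
      ∀ x, ∑' n : ℕ, ∑' y, matPow (fun x y => q x (φ x) y) n x y ≤ K) :
    ∃ μ : X → ℝ≥0∞, (∀ x, μ x ≤ K) ∧
      ∀ x, ∀ a ∈ Act x, 1 + ∑' y, q x a y * μ y ≤ μ x := by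
  classical
  let P : (X → A) → X → X → ℝ≥0∞ := fun φ x y => q x (φ x) y
  let v : (X → A) → X → ℝ≥0∞ := fun φ x => ∑' n, rowMass (P φ) n x
  let w : X → ℝ≥0∞ := fun x => ⨆ φ : {φ : X → A // ∀ x, φ x ∈ Act x}, v φ x
  have hvK : ∀ φ, (∀ x, φ x ∈ Act x) → ∀ x, v φ x ≤ K := hT
  have hvw : ∀ φ, (∀ x, φ x ∈ Act x) → ∀ x, v φ x ≤ w x := fun φ hφ x =>
    le_iSup (fun φ : {φ : X → A // ∀ x, φ x ∈ Act x} => v φ x) ⟨φ, hφ⟩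
  have hwK : ∀ x, w x ≤ K := fun x => iSup_le fun φ => hvK φ φ.2 x
  have hv : ∀ φ x, v φ x = 1 + ∑' z, q x (φ x) z * v φ z := fun φ x => tsum_rowMass_eq (P φ) x
  have hw0 : ∀ x, w x ≠ 0 := by
    intro x
    choose φ hφ using hAct
    refine (lt_of_lt_of_le zero_lt_one (le_trans ?_ (hvw φ hφ x))).ne'
    rw [hv]
    exact le_self_add
  refine ⟨w, hwK, fun x₀ a ha => ?_⟩
  by_contra! hlt
  have hwx : ∀ x, w x ≠ ⊤ := fun x => ne_top_of_le_ne_top hKtop (hwK x)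
  refine hlt.not_ge (ENNReal.le_of_forall_pos_le_add fun δ hδ _ => ?_)
  obtain ⟨ε, hε0, hε⟩ : ∃ ε : ℝ≥0∞, ε ≠ 0 ∧ ε * K ≤ δ := by
    refine ⟨δ / K, ?_, (ENNReal.div_mul_cancel (one_pos.trans_le hK1).ne' hKtop).le⟩
    exact (ENNReal.div_pos (by exact_mod_cast hδ.ne') hKtop).ne'
  have hnear : ∀ x, ∃ φ : X → A, (∀ x, φ x ∈ Act x) ∧ w x ≤ v φ x + ε := by
    intro x
    obtain ⟨φ, hφ⟩ := lt_iSup_iff.1 (ENNReal.sub_lt_self (hwx x) (hw0 x) hε0)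
    exact ⟨φ, φ.2, tsub_le_iff_right.1 hφ.le⟩
  choose ψ hψ hψw using hnear
  let φ : X → A := fun x => if x = x₀ then a else ψ x x
  have hφ : ∀ x, φ x ∈ Act x := by
    intro x
    by_cases h : x = x₀
    · subst h
      simpa [φ] using ha
    · simpa [φ, h] using hψ x x
  have hsub : ∀ x, w x ≤ (1 + ε) + ∑' z, P φ x z * w z := by
    intro x
    by_cases h : x = x₀
    · subst h
      simp only [P, φ, if_true]
      refine hlt.le.trans ?_
      gcongr
      exact le_self_add
    · simp only [P, φ, h, if_false]
      refine (hψw x).trans ?_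
      rw [hv, add_right_comm]
      gcongr with z
      exact hvw _ (hψ x) z
  have hwv : ∀ x, w x ≤ (1 + ε) * v φ x := fun x =>
    le_mul_tsum_rowMass hKtop hwK hsub x (ne_top_of_le_ne_top hKtop (hvK φ hφ x))
  calc 1 + ∑' y, q x₀ a y * w y
      ≤ (1 + ε) * 1 + ∑' y, q x₀ a y * ((1 + ε) * v φ y) := by
        gcongr with y
        · simp
        · exact hwv y
    _ = (1 + ε) * v φ x₀ := by
        rw [hv φ x₀, mul_add, ← ENNReal.tsum_mul_left]
        simp only [φ, if_true, mul_left_comm]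
    _ ≤ (1 + ε) * w x₀ := by
        gcongr
        exact hvw φ hφ x₀
    _ = w x₀ + ε * w x₀ := by ring
    _ ≤ w x₀ + δ := by
        gcongr
        exact (mul_le_mul_right (hwK x₀) ε).trans hε
end

section
/- Let X be countable, β ∈ [0,1), and suppose a bounded function u : X → ℝ satisfies u(x) = min_{a∈A(x)} [c(x,a) + Σ_{y∈X} q(y|x,a) u(y)] (undiscounted optimality equation), where μ : X → [1,K] satisfies μ(x) ≥ 1 + Σ_y q(y|x,a)μ(y) and the HV transformation with discount β̃ ∈ [(K−1)/K,1) is applied. Then the bounded function ũ(x) := u(x)/μ(x) (extended by ũ(x̃) = 0) satisfies the discounted optimality equation ũ(x) = min_{a∈A(x)} [c̃(x,a) + β̃ Σ_{y∈X̃} p̃(y|x,a) ũ(y)] for the transformed MDP. -/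
theorem tsum_option_eq_tsum_some {X : Type*} (f : Option X → ℝ) (hf : f none = 0) :
    ∑' z, f z = ∑' y, f (some y) := by
  refine ((Option.some_injective X).tsum_eq fun z hz => ?_).symm
  cases z with
  | none => exact absurd hf hz
  | some y => exact ⟨y, rfl⟩

/-- uniqueness-transfer step of Theorem 1(i): if a bounded `u` satisfies
the undiscounted optimality equation `u(x) = min_{a∈A(x)} [c(x,a) + ∑_y q(y|x,a) u(y)]`,
then `ũ = u/μ` (extended by `ũ(x̃) = 0`) satisfies the discounted optimality equation of
the HV-transformed MDP. -/
theorem stmt13 {X A : Type*} [Countable X]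
    (Act : X → Set A) (hAct : ∀ x, (Act x).Nonempty)
    (q : X → A → X → ℝ) (hq0 : ∀ x a y, 0 ≤ q x a y) (hqs : ∀ x a, Summable (q x a))
    (hqb : ∃ C : ℝ, ∀ x, ∀ a ∈ Act x, ∑' y, q x a y ≤ C)
    (c : X → A → ℝ) (Cc : ℝ) (hc : ∀ x a, |c x a| ≤ Cc)
    (K : ℝ) (hK : 1 ≤ K)
    (μ : X → ℝ) (hμ1 : ∀ x, 1 ≤ μ x) (hμK : ∀ x, μ x ≤ K)
    (hμ : ∀ x, ∀ a ∈ Act x, 1 + ∑' y, q x a y * μ y ≤ μ x)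
    (β : ℝ) (hβl : (K - 1) / K ≤ β) (hβu : β < 1)
    (u : X → ℝ) (Cu : ℝ) (hub : ∀ x, |u x| ≤ Cu)
    (hu : ∀ x, u x = ⨅ a : Act x, (c x a + ∑' y, q x a y * u y)) :
    letI ut : Option X → ℝ := fun z =>
      match z with
      | some x => u x / μ x
      | none => 0
    letI pt : (x : X) → A → Option X → ℝ := fun x a z =>
      match z with
      | some y => q x a y * μ y / (β * μ x)
      | none => 1 - (∑' y, q x a y * μ y) / (β * μ x)
    ∀ x : X, ut (some x)
        = ⨅ a : Act x, (c x a / μ x + β * ∑' z : Option X, pt x a z * ut z) := by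
  intro x
  have hμpos : ∀ y, 0 < μ y := fun y => zero_lt_one.trans_le (hμ1 y)
  have hKpos : 0 < K := zero_lt_one.trans_le hK
  have hβ0 : 0 ≤ β := (div_nonneg (sub_nonneg.2 hK) hKpos.le).trans hβl
  have zero_of_discount_zero : β = 0 → ∀ a ∈ Act x, ∀ y, q x a y = 0 := by
    intro hβ a ha y
    have hK1 : K ≤ 1 := by
      rw [hβ, div_le_iff₀ hKpos] at hβl
      linarith
    have hμ_one : ∀ z, μ z = 1 := fun z => le_antisymm ((hμK z).trans hK1) (hμ1 z)
    have hsum := hμ x a ha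
    simp only [hμ_one, mul_one] at hsum
    have hle := (hqs x a).le_tsum y fun z _ => hq0 x a z
    exact le_antisymm (by linarith) (hq0 x a y)
  have key : ∀ a : Act x,
      c x a / μ x + β * ∑' z : Option X,
        (match z with
          | some y => q x a y * μ y / (β * μ x)
          | none => 1 - (∑' y, q x a y * μ y) / (β * μ x)) *
        (match z with
          | some x => u x / μ x
          | none => 0) = (μ x)⁻¹ * (c x a + ∑' y, q x a y * u y) := by
    intro a
    rw [tsum_option_eq_tsum_some _ (by simp), ← tsum_mul_left, mul_add, ← tsum_mul_left,
      div_eq_inv_mul]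
    congr 1
    refine tsum_congr fun y => ?_
    have hx := (hμpos x).ne'
    have hy := (hμpos y).ne'
    rcases eq_or_ne β 0 with hβ | hβ
    · simp [zero_of_discount_zero hβ a a.2 y]
    · field_simp
  refine Eq.trans ?_ (iInf_congr key).symm
  rw [← Real.mul_iInf_of_nonneg (inv_nonneg.2 (hμpos x).le), ← hu x]
  exact div_eq_inv_mul _ _
end
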